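/- Let T be a tree and T' a subtree of T with at least 2 vertices. Then for all real q, the second smallest eigenvalue of L_{T'}^q is at least the second smallest eigenvalue of L_T^q. -/

import Mathlib

open Matrix SimpleGraph

/- The `q`-Laplacian of a graph: `I + q^2 (D - I) - q A`, where `D` is the diagonal
degree matrix and `A` the adjacency matrix. -/
open Classical in
noncomputable def qLap {V : Type*} [Fintype V] [DecidableEq V]
    (G : SimpleGraph V) (q : ℝ) : Matrix V V ℝ :=
  1 + q ^ 2 • (Matrix.diagonal (fun i => ((G.neighborSet i).ncard : ℝ)) - 1)
    - q • Matrix.of (fun i j => if G.Adj i j then (1 : ℝ) else 0)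

open Classical in
/-- The quadratic form of the `q`-Laplacian of the subgraph of `G` induced on `S`. -/
noncomputable def qForm {V : Type*} (G : SimpleGraph V) (q : ℝ) (S : Finset V) (x : V → ℝ) : ℝ :=
  ∑ i ∈ S, ((1 - q ^ 2) * x i ^ 2 +
    ∑ j ∈ S, if G.Adj i j then q ^ 2 * x i ^ 2 - q * x i * x j else 0)

lemma qForm_singleton {V : Type*} (G : SimpleGraph V) (q : ℝ) (r : V) (x : V → ℝ) :
    qForm G q {r} x = (1 - q ^ 2) * x r ^ 2 := by
  simp [qForm]

lemma qForm_congr {V : Type*} (G : SimpleGraph V) (q : ℝ) {S : Finset V} {x y : V → ℝ}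
    (h : ∀ i ∈ S, x i = y i) : qForm G q S x = qForm G q S y := by
  unfold qForm
  refine Finset.sum_congr rfl fun i hi => ?_
  rw [h i hi]
  congr 1
  refine Finset.sum_congr rfl fun j hj => ?_
  rw [h j hj]

lemma isHermitian_qLap {V : Type*} [Fintype V] [DecidableEq V] (G : SimpleGraph V) (q : ℝ) :
    (qLap G q).IsHermitian := by
  classical
  ext i j
  simp only [qLap, conjTranspose_apply, star_trivial, Matrix.sub_apply, Matrix.add_apply, Matrix.smul_apply, of_apply,
    G.adj_comm j i, one_apply, diagonal_apply, eq_comm (a := j)]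
  split_ifs with h <;> simp_all

lemma dotProduct_qLap_mulVec {V : Type*} [Fintype V] [DecidableEq V] (G : SimpleGraph V) (q : ℝ)
    (x : V → ℝ) : x ⬝ᵥ qLap G q *ᵥ x = qForm G q Finset.univ x := by
  classical
  unfold qForm
  rw [dotProduct]
  refine Finset.sum_congr rfl fun i _ => ?_
  have hcard : ((G.neighborSet i).ncard : ℝ) = ∑ j, if G.Adj i j then (1 : ℝ) else 0 := by
    rw [Finset.sum_boole, Set.ncard_eq_toFinset_card']
    congr 2
    ext j
    simp
  have hA : (of (fun i j => if G.Adj i j then (1 : ℝ) else 0) *ᵥ x) i =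
      ∑ j, if G.Adj i j then x j else 0 := by
    simp [mulVec, dotProduct]
  simp only [qLap, sub_mulVec, add_mulVec, smul_mulVec, one_mulVec, Pi.sub_apply, Pi.add_apply,
    Pi.smul_apply, mulVec_diagonal, smul_eq_mul, hcard, hA]
  have : ∀ j, (if G.Adj i j then q ^ 2 * x i ^ 2 - q * x i * x j else 0) =
      q ^ 2 * x i ^ 2 * (if G.Adj i j then (1 : ℝ) else 0)
        - q * x i * (if G.Adj i j then x j else 0) := by
    intro j
    split_ifs <;> ring
  simp only [this, Finset.sum_sub_distrib, ← Finset.mul_sum]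
  ring

lemma qForm_induce_univ {V : Type*} (G : SimpleGraph V) (q : ℝ) (S : Finset V)
    [Fintype (S : Set V)] (x : V → ℝ) :
    qForm (G.induce (S : Set V)) q Finset.univ (fun i => x i) = qForm G q S x := by
  classical
  have key : ∀ f : V → ℝ, ∑ i : (S : Set V), f i = ∑ i ∈ S, f i := fun f =>
    (Finset.sum_subtype S (fun _ => Finset.mem_coe.symm) f).symm
  simp only [qForm, induce_adj]
  rw [← key]
  refine Finset.sum_congr rfl fun i _ => ?_
  rw [← key]

lemma qForm_insert {V : Type*} [DecidableEq V] (G : SimpleGraph V) (q : ℝ) {S : Finset V} {u v : V}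
    (hv : v ∉ S) (hu : u ∈ S) (hadj : ∀ w ∈ S, G.Adj v w ↔ w = u) (x : V → ℝ) :
    qForm G q (insert v S) x = qForm G q S x + (x v - q * x u) ^ 2 := by
  classical
  unfold qForm
  rw [Finset.sum_insert hv, Finset.sum_insert hv]
  simp only [Finset.sum_insert hv, ← add_assoc]
  have h1 : ∑ j ∈ S, (if G.Adj v j then q ^ 2 * x v ^ 2 - q * x v * x j else 0) =
      q ^ 2 * x v ^ 2 - q * x v * x u := by
    rw [Finset.sum_congr rfl (g := fun j => if j = u then q ^ 2 * x v ^ 2 - q * x v * x j else 0)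
      (fun j hj => by simp only [hadj j hj])]
    simp [hu]
  have h2 : ∑ i ∈ S, (if G.Adj i v then q ^ 2 * x i ^ 2 - q * x i * x v else 0) =
      q ^ 2 * x u ^ 2 - q * x u * x v := by
    rw [Finset.sum_congr rfl (g := fun j => if j = u then q ^ 2 * x j ^ 2 - q * x j * x v else 0)
      (fun j hj => by simp only [G.adj_comm j v, hadj j hj])]
    simp [hu]
  simp only [Finset.sum_add_distrib, h1, h2, SimpleGraph.irrefl, if_false]
  ring

lemma SimpleGraph.IsAcyclic.eq_of_adj_of_connected_induce {V : Type*} {G : SimpleGraph V}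
    (hG : G.IsAcyclic) {S : Set V} (hS : (G.induce S).Connected) {u v w : V} (hv : v ∉ S)
    (hu : u ∈ S) (hw : w ∈ S) (hvu : G.Adj v u) (hvw : G.Adj v w) : w = u := by
  by_contra hne
  obtain ⟨p, hp⟩ := (hS.preconnected ⟨w, hw⟩ ⟨u, hu⟩).exists_isPath
  let P : G.Path w u := ⟨p.map (SimpleGraph.Embedding.induce (G := G) S).toHom,
    hp.map (SimpleGraph.Embedding.induce (G := G) S).injective⟩
  let Q : G.Path w u := ⟨.cons hvw.symm (.cons hvu .nil), by
    simp [Walk.cons_isPath_iff, hne, hvu.ne, hvw.ne']⟩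
  have hPQ : P = Q := (hG.subsingleton_path w u).elim P Q
  have hmem : v ∈ (p.map (SimpleGraph.Embedding.induce (G := G) S).toHom).support := by
    rw [show p.map (SimpleGraph.Embedding.induce (G := G) S).toHom = (Q : G.Walk w u) from
      congrArg Subtype.val hPQ]
    simp [Q]
  rw [Walk.support_map, List.mem_map] at hmem
  obtain ⟨a, -, ha⟩ := hmem
  exact hv (ha ▸ a.2)

/-- A proper connected subgraph of a tree can be enlarged by a pendant vertex. -/
lemma SimpleGraph.IsTree.exists_pendant {V : Type*} [Fintype V] [DecidableEq V] {G : SimpleGraph V}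
    (hG : G.IsTree) {S : Finset V} (hS : (G.induce (S : Set V)).Connected)
    (hne : S ≠ Finset.univ) :
    ∃ u ∈ S, ∃ v ∉ S, (∀ w ∈ S, G.Adj v w ↔ w = u) ∧
      (G.induce ((insert v S : Finset V) : Set V)).Connected := by
  obtain ⟨z, hz⟩ : ∃ z, z ∉ S := by
    by_contra! h
    exact hne (Finset.eq_univ_of_forall h)
  obtain ⟨⟨r, hr⟩⟩ := hS.nonempty
  obtain ⟨p⟩ := hG.connected.preconnected r z
  obtain ⟨d, -, hu, hv⟩ := p.exists_boundary_dart (S : Set V) hr hz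
  refine ⟨d.fst, hu, d.snd, hv, fun w hw => ⟨fun h => ?_, ?_⟩, ?_⟩
  · exact hG.isAcyclic.eq_of_adj_of_connected_induce hS hv hu hw d.adj.symm h
  · rintro rfl
    exact d.adj.symm
  · have h1 : (G.induce ({d.snd} : Set V)).Preconnected := by
      rw [induce_singleton_eq_top]
      exact preconnected_top
    have := connected_induce_union hS.preconnected h1 hu (Set.mem_singleton _) d.adj
    rwa [Finset.coe_insert, Set.insert_eq, Set.union_comm]

lemma SimpleGraph.IsTree.induction_pendant {V : Type*} [Fintype V] [DecidableEq V] {G : SimpleGraph V}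
    (hG : G.IsTree) {motive : Finset V → Prop} (univ : motive Finset.univ)
    (insert : ∀ (S : Finset V) (u v : V), u ∈ S → v ∉ S → (∀ w ∈ S, G.Adj v w ↔ w = u) →
      motive (insert v S) → motive S)
    (S : Finset V) (hS : (G.induce (S : Set V)).Connected) : motive S := by
  by_cases hne : S = Finset.univ
  · exact hne ▸ univ
  · obtain ⟨u, hu, v, hv, hadj, hconn⟩ := hG.exists_pendant hS hne
    have hlt : (Finset.univ \ Insert.insert v S).card < (Finset.univ \ S).card := by
      refine Finset.card_lt_card ⟨fun a => by simp +contextual, fun h => ?_⟩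
      simpa using h (show v ∈ Finset.univ \ S by simpa using hv)
    exact insert S u v hu hv hadj (hG.induction_pendant univ insert _ hconn)
termination_by (Finset.univ \ S).card
decreasing_by exact hlt

lemma qForm_le_qForm_univ {V : Type*} [Fintype V] {G : SimpleGraph V} (hG : G.IsTree) (q : ℝ)
    (S : Finset V) (hS : (G.induce (S : Set V)).Connected) (x : V → ℝ) :
    qForm G q S x ≤ qForm G q Finset.univ x := by
  classical
  refine hG.induction_pendant (motive := fun S => qForm G q S x ≤ qForm G q Finset.univ x)
    le_rfl (fun S u v hu hv hadj ih => ?_) S hS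
  rw [qForm_insert G q hv hu hadj] at ih
  nlinarith [sq_nonneg (x v - q * x u)]

lemma exists_linear_extension {V : Type*} [Fintype V] {G : SimpleGraph V} (hG : G.IsTree) (q : ℝ)
    (S : Finset V) (hS : (G.induce (S : Set V)).Connected) :
    ∃ E : (V → ℝ) →ₗ[ℝ] (V → ℝ), ∀ x, (∀ i ∈ S, E x i = x i) ∧
      qForm G q Finset.univ (E x) = qForm G q S x := by
  classical
  refine hG.induction_pendant (motive := fun S => ∃ E : (V → ℝ) →ₗ[ℝ] (V → ℝ), ∀ x,
    (∀ i ∈ S, E x i = x i) ∧ qForm G q Finset.univ (E x) = qForm G q S x)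
    ⟨LinearMap.id, by simp⟩ (fun S u v hu hv hadj ih => ?_) S hS
  obtain ⟨E, hE⟩ := ih
  let F : (V → ℝ) →ₗ[ℝ] (V → ℝ) :=
    LinearMap.pi fun i => if i = v then q • LinearMap.proj u else LinearMap.proj i
  have hF : ∀ x, ∀ i ∈ S, F x i = x i := fun x i hi => by
    simp [F, ne_of_mem_of_not_mem hi hv]
  refine ⟨E ∘ₗ F, fun x => ⟨fun i hi => ?_, ?_⟩⟩
  · rw [LinearMap.comp_apply, (hE _).1 i (Finset.mem_insert_of_mem hi), hF x i hi]
  · rw [LinearMap.comp_apply, (hE _).2]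
    have := qForm_insert G q hv hu hadj (F x)
    rw [qForm_congr G q (hF x), hF x u hu] at this
    convert this using 1
    simp [F]

/-- An antitone enumeration of the roots of the characteristic polynomial of a real symmetric
matrix comes from an orthonormal basis of eigenvectors. -/
lemma Matrix.IsHermitian.exists_orthonormalBasis {V : Type*} [Fintype V] [DecidableEq V] {n : ℕ}
    {A : Matrix V V ℝ} (hA : A.IsHermitian) {μ : Fin n → ℝ} (hμ : Antitone μ)
    (hroots : A.charpoly.roots = ↑(List.ofFn μ)) :
    ∃ b : OrthonormalBasis (Fin n) ℝ (EuclideanSpace ℝ V), ∀ i, A *ᵥ (b i) = μ i • (b i) := by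
  have hsort : List.ofFn hA.eigenvalues₀ = List.ofFn μ := by
    rw [← hA.sort_roots_charpoly_eq_eigenvalues₀]
    simp only [hroots, Multiset.map_coe, RCLike.re_to_real, List.map_id', Multiset.coe_sort]
    apply List.mergeSort_of_pairwise
    simp_rw [decide_eq_true_eq, ← List.sortedGE_iff_pairwise]
    exact hμ.sortedGE_ofFn
  have hn : Fintype.card V = n := by simpa using congrArg List.length hsort
  subst hn
  have hμ' := List.ofFn_inj.mp hsort
  let e : Fin (Fintype.card V) ≃ V := Fintype.equivOfCardEq (Fintype.card_fin _)
  refine ⟨hA.eigenvectorBasis.reindex e.symm, fun i => ?_⟩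
  have := hA.mulVec_eigenvectorBasis (e i)
  have he : hA.eigenvalues (e i) = μ i := by
    rw [← hμ', Matrix.IsHermitian.eigenvalues]
    congr 1
    exact e.symm_apply_apply i
  simpa [he] using this

lemma dotProduct_mulVec_eq_sum_eigenvalues {V : Type*} [Fintype V] {n : ℕ}
    {A : Matrix V V ℝ} {μ : Fin n → ℝ} (b : OrthonormalBasis (Fin n) ℝ (EuclideanSpace ℝ V))
    (hb : ∀ i, A *ᵥ (b i) = μ i • (b i)) (x : V → ℝ) :
    x ⬝ᵥ A *ᵥ x = ∑ i, μ i * ((b i).ofLp ⬝ᵥ x) ^ 2 := by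
  have hinner : ∀ i, inner ℝ (b i) (WithLp.toLp 2 x) = (b i).ofLp ⬝ᵥ x := fun i => by
    rw [EuclideanSpace.inner_eq_star_dotProduct, star_trivial, dotProduct_comm]
  have hx : ∑ i, ((b i).ofLp ⬝ᵥ x) • (b i).ofLp = x := by
    have := congrArg WithLp.ofLp (b.sum_repr' (WithLp.toLp 2 x))
    simpa only [hinner, WithLp.ofLp_sum, WithLp.ofLp_smul] using this
  nth_rw 2 [← hx]
  simp only [mulVec_sum, mulVec_smul, hb, dotProduct_sum, dotProduct_smul, smul_eq_mul]
  refine Finset.sum_congr rfl fun i _ => ?_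
  rw [dotProduct_comm x]
  ring

lemma dotProduct_self_eq_sum {V : Type*} [Fintype V] {n : ℕ}
    (b : OrthonormalBasis (Fin n) ℝ (EuclideanSpace ℝ V)) (x : V → ℝ) :
    x ⬝ᵥ x = ∑ i, ((b i).ofLp ⬝ᵥ x) ^ 2 := by
  classical
  simpa using dotProduct_mulVec_eq_sum_eigenvalues (A := 1) (μ := 1) b (by simp) x

/-- On some hyperplane the Rayleigh quotient is at least the second smallest eigenvalue. -/
lemma exists_linearMap_le_rayleigh {V : Type*} [Fintype V] [DecidableEq V] {n : ℕ}
    (hn : 2 ≤ n) {A : Matrix V V ℝ} (hA : A.IsHermitian) {μ : Fin n → ℝ} (hμ : Antitone μ)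
    (hroots : A.charpoly.roots = ↑(List.ofFn μ)) :
    ∃ l : (V → ℝ) →ₗ[ℝ] ℝ, ∀ x, l x = 0 →
      μ ⟨n - 2, by omega⟩ * (x ⬝ᵥ x) ≤ x ⬝ᵥ A *ᵥ x := by
  obtain ⟨b, hb⟩ := hA.exists_orthonormalBasis hμ hroots
  refine ⟨dotProductBilin ℝ ℝ (b ⟨n - 1, by omega⟩).ofLp, fun x hx => ?_⟩
  change (b ⟨n - 1, by omega⟩).ofLp ⬝ᵥ x = 0 at hx
  rw [dotProduct_mulVec_eq_sum_eigenvalues b hb, dotProduct_self_eq_sum b, Finset.mul_sum]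
  refine Finset.sum_le_sum fun i _ => ?_
  by_cases hi : i = ⟨n - 1, by omega⟩
  · simp [hi, hx]
  · refine mul_le_mul_of_nonneg_right (hμ ?_) (sq_nonneg _)
    rw [Fin.ext_iff] at hi
    rw [Fin.le_def]
    have := i.2
    simp only at hi ⊢
    omega

/-- Every hyperplane contains a nonzero vector whose Rayleigh quotient is at most the second
smallest eigenvalue. -/
lemma exists_ne_zero_rayleigh_le {V : Type*} [Fintype V] [DecidableEq V] {n : ℕ}
    (hn : 2 ≤ n) {A : Matrix V V ℝ} (hA : A.IsHermitian) {μ : Fin n → ℝ} (hμ : Antitone μ)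
    (hroots : A.charpoly.roots = ↑(List.ofFn μ)) (l : (V → ℝ) →ₗ[ℝ] ℝ) :
    ∃ x : V → ℝ, l x = 0 ∧ 0 < x ⬝ᵥ x ∧ x ⬝ᵥ A *ᵥ x ≤ μ ⟨n - 2, by omega⟩ * (x ⬝ᵥ x) := by
  obtain ⟨b, hb⟩ := hA.exists_orthonormalBasis hμ hroots
  let i : Fin n := ⟨n - 2, by omega⟩
  let j : Fin n := ⟨n - 1, by omega⟩
  have hij : i ≠ j := by
    simp only [i, j, ne_eq, Fin.mk.injEq]
    omega
  have hle : μ j ≤ μ i := hμ (by simp only [i, j, Fin.mk_le_mk]; omega)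
  have horth : ∀ k k', (b k).ofLp ⬝ᵥ (b k').ofLp = if k = k' then 1 else 0 := fun k k' => by
    rw [← orthonormal_iff_ite.mp b.orthonormal k k', EuclideanSpace.inner_eq_star_dotProduct,
      star_trivial, dotProduct_comm]
  obtain ⟨α, β, hl, hne⟩ : ∃ α β : ℝ, α * l (b i).ofLp + β * l (b j).ofLp = 0 ∧
      0 < α ^ 2 + β ^ 2 := by
    by_cases h : l (b i).ofLp = 0
    · exact ⟨1, 0, by simp [h], by norm_num⟩
    · exact ⟨-l (b j).ofLp, l (b i).ofLp, by ring, by positivity⟩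
  have hself : (α • (b i).ofLp + β • (b j).ofLp) ⬝ᵥ (α • (b i).ofLp + β • (b j).ofLp) =
      α ^ 2 + β ^ 2 := by
    simp [horth, hij, hij.symm]
    ring
  have hquad : (α • (b i).ofLp + β • (b j).ofLp) ⬝ᵥ A *ᵥ (α • (b i).ofLp + β • (b j).ofLp) =
      μ i * α ^ 2 + μ j * β ^ 2 := by
    simp [mulVec_add, mulVec_smul, hb, horth, hij, hij.symm]
    ring
  refine ⟨α • (b i).ofLp + β • (b j).ofLp, by simpa using hl, by rwa [hself], ?_⟩
  rw [hself, hquad, mul_add]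
  gcongr

/- A subtree (connected induced subgraph) `T'` on vertex set `s` with at least two
vertices has second smallest `q`-Laplacian eigenvalue at least that of the tree `T`.
Eigenvalues are given by antitone enumerations `μ` (for `T`, on `m+2` vertices) and
`μ'` (for `T'`); the second smallest eigenvalues are `μ ⟨m,_⟩` and `μ' ⟨s.card-2,_⟩`. -/
theorem qLap_subtree_second_smallest_ge {m : ℕ}
    (G : SimpleGraph (Fin (m + 2))) (hT : G.IsTree)
    (s : Finset (Fin (m + 2))) (hs2 : 2 ≤ s.card)
    (hconn : (G.induce (s : Set (Fin (m + 2)))).Connected) (q : ℝ)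
    (μ : Fin (m + 2) → ℝ) (hμ : Antitone μ)
    (hroots : (qLap G q).charpoly.roots = ↑(List.ofFn μ))
    (μ' : Fin s.card → ℝ) (hμ' : Antitone μ')
    (hroots' : (qLap (G.induce (s : Set (Fin (m + 2)))) q).charpoly.roots = ↑(List.ofFn μ')) :
    μ' (⟨s.card - 2, by omega⟩ : Fin s.card) ≥ μ (⟨m, by omega⟩ : Fin (m + 2)) := by
  have hindTree : (G.induce (s : Set (Fin (m + 2)))).IsTree := ⟨hconn, hT.isAcyclic.induce _⟩
  have hnonneg : 0 ≤ μ' ⟨s.card - 2, by omega⟩ := by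
    obtain ⟨r⟩ := hconn.nonempty
    obtain ⟨x, hx, hpos, hle⟩ := exists_ne_zero_rayleigh_le hs2
      (isHermitian_qLap (G.induce (s : Set (Fin (m + 2)))) q) hμ' hroots' (LinearMap.proj r)
    have hr : ((G.induce (s : Set (Fin (m + 2)))).induce
        (({r} : Finset (s : Set (Fin (m + 2)))) : Set (s : Set (Fin (m + 2))))).Connected := by
      rw [Finset.coe_singleton, induce_singleton_eq_top]
      exact connected_top
    have hge := qForm_le_qForm_univ hindTree q {r} hr x
    rw [LinearMap.proj_apply] at hx
    rw [qForm_singleton, hx] at hge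
    rw [dotProduct_qLap_mulVec] at hle
    by_contra! hneg
    nlinarith
  obtain ⟨E, hE⟩ := exists_linear_extension hT q s hconn
  obtain ⟨l, hl⟩ := exists_linearMap_le_rayleigh (by omega) (isHermitian_qLap G q) hμ hroots
  let Z : (↥(s : Set (Fin (m + 2))) → ℝ) →ₗ[ℝ] (Fin (m + 2) → ℝ) :=
    LinearMap.pi fun i => if h : i ∈ s then LinearMap.proj ⟨i, h⟩ else 0
  obtain ⟨x, hx, hpos, hle⟩ := exists_ne_zero_rayleigh_le hs2
    (isHermitian_qLap (G.induce (s : Set (Fin (m + 2)))) q) hμ' hroots' (l ∘ₗ E ∘ₗ Z)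
  have hZ : (fun i : (s : Set (Fin (m + 2))) => Z x i) = x := by
    ext ⟨i, hi⟩
    simp [Z, Finset.mem_coe.mp hi]
  have hge := hl (E (Z x)) hx
  rw [dotProduct_qLap_mulVec, (hE _).2, ← qForm_induce_univ, hZ] at hge
  rw [dotProduct_qLap_mulVec] at hle
  have hnorm : x ⬝ᵥ x ≤ E (Z x) ⬝ᵥ E (Z x) := by
    have h1 : x ⬝ᵥ x = ∑ i ∈ s, E (Z x) i * E (Z x) i := by
      rw [Finset.sum_congr rfl fun i hi => by rw [(hE (Z x)).1 i hi],
        Finset.sum_subtype s (fun _ => Finset.mem_coe.symm), dotProduct]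
      exact Finset.sum_congr rfl fun i _ => by rw [← congrFun hZ i]
    rw [h1, dotProduct]
    exact Finset.sum_le_sum_of_subset_of_nonneg (Finset.subset_univ _)
      fun i _ _ => mul_self_nonneg _
  have := mul_le_mul_of_nonneg_left hnorm hnonneg
  exact le_of_mul_le_mul_right (hge.trans (hle.trans this)) (hpos.trans_le hnorm)
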